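/- For a graph G the following are equivalent: (1) G is closed with respect to some labelling of its vertices; (2) the clique complex Δ(G) is a closed (linear quasi-tree) complex; (3) the binomial edge ideal J_G has a quadratic Gröbner basis with respect to some term order. -/

import Mathlib

open MvPolynomial

/-- The exponent vector of the monomial `x_i * y_j` in `K[x_1,…,x_n,y_1,…,y_n]`,
where the variable set is `Fin n ⊕ Fin n` (`inl` for `x`, `inr` for `y`). -/
noncomputable def xy {n : ℕ} (i j : Fin n) : (Fin n ⊕ Fin n) →₀ ℕ :=
  Finsupp.single (Sum.inl i) 1 + Finsupp.single (Sum.inr j) 1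

/-- The generators `f_{ij} = x_i y_j - x_j y_i` of the binomial edge ideal of `G`. -/
def edgeGens (n : ℕ) (K : Type*) [Field K] (G : SimpleGraph (Fin n)) :
    Set (MvPolynomial (Fin n ⊕ Fin n) K) :=
  {f | ∃ i j : Fin n, i < j ∧ G.Adj i j ∧
    f = X (Sum.inl i) * X (Sum.inr j) - X (Sum.inl j) * X (Sum.inr i)}

/-- The leading monomial (with coefficient `1`) of `f` with respect to the term order `m`. -/
noncomputable def ldMon {σ K : Type*} [Field K] (m : MonomialOrder σ)
    (f : MvPolynomial σ K) : MvPolynomial σ K :=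
  monomial (m.toSyn.symm (f.support.sup fun d => m.toSyn d)) (1 : K)

/-- The generators `f_{ij}` of the binomial edge ideal `J_G` form a (quadratic) Gröbner
basis with respect to the term order `m`: their leading monomials generate the initial
ideal of `J_G`. -/
def HasQuadGB {n : ℕ} (K : Type*) [Field K] (G : SimpleGraph (Fin n))
    (m : MonomialOrder (Fin n ⊕ Fin n)) : Prop :=
  Ideal.span (ldMon m '' edgeGens n K G) =
    Ideal.span (ldMon m '' {f | f ∈ Ideal.span (edgeGens n K G) ∧ f ≠ 0})

/-- `G` is closed with respect to the (strict) ordering `lt` of its vertices: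
for any two edges sharing the smaller endpoint the two larger endpoints are adjacent,
and for any two edges sharing the larger endpoint the two smaller endpoints are adjacent. -/
def ClosedWrt {V : Type*} (G : SimpleGraph V) (lt : V → V → Prop) : Prop :=
  ∀ i j k : V, G.Adj i j → G.Adj i k → j ≠ k →
    ((lt i j → lt i k → G.Adj j k) ∧ (lt j i → lt k i → G.Adj j k))

/-- `F b` is a branch of the facet `F i` in the subcomplex `⟨F lo, …, F (r-1)⟩`:
`b ≠ i` and every other facet meets `F i` inside `F b ∩ F i`. -/
def BranchOf {V : Type*} [DecidableEq V] (F : ℕ → Finset V) (lo r i b : ℕ) : Prop :=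
  lo ≤ b ∧ b < r ∧ b ≠ i ∧
    ∀ j, lo ≤ j → j < r → j ≠ i → j ≠ b → F j ∩ F i ⊆ F b ∩ F i

/-- The complex with facets `F 0, …, F (r-1)` is a linear quasi-tree for this order:
each `F i` is a leaf of the subcomplex `⟨F i, …, F (r-1)⟩` and `F (i+1)` is its only
branch there. -/
def LinearQuasiTree {V : Type*} [DecidableEq V] (F : ℕ → Finset V) (r : ℕ) : Prop :=
  ∀ i, i + 1 < r →
    (BranchOf F i r i (i + 1) ∧ ∀ b, BranchOf F i r i b → b = i + 1)

/-- A closed linear quasi-tree: a linear quasi-tree satisfying the incomparability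
condition (I) and the covering condition (C). -/
def ClosedLQT {V : Type*} [DecidableEq V] (F : ℕ → Finset V) (r : ℕ) : Prop :=
  LinearQuasiTree F r ∧
  -- (I) incomparability
  (∀ i j k l, i ≤ j → k ≤ l → i < k → j < l → j < r → l < r →
    (F i ∩ F j).Nonempty → (F k ∩ F l).Nonempty →
    ¬ F i ∩ F j ⊆ F k ∩ F l ∧ ¬ F k ∩ F l ⊆ F i ∩ F j) ∧
  -- (C) covering
  (∀ i d, 1 ≤ d → i + d + 1 < r → (F i ∩ F (i + d + 1)).Nonempty →
    F (i + 1) ∩ F (i + d) = (F i ∩ F (i + d)) ∪ (F (i + 1) ∩ F (i + d + 1)))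

/-- `s` is a facet of the clique complex `Δ(G)`, i.e. a maximal clique of `G`. -/
def IsFacet {V : Type*} (G : SimpleGraph V) (s : Finset V) : Prop :=
  G.IsClique (s : Set V) ∧ ∀ t : Finset V, G.IsClique (t : Set V) → s ⊆ t → s = t

/-- `F 0, …, F (r-1)` is an enumeration (without repetitions) of the facets of the
clique complex `Δ(G)`. -/
def FacetEnum {V : Type*} (G : SimpleGraph V) (F : ℕ → Finset V) (r : ℕ) : Prop :=
  (∀ i, i < r → IsFacet G (F i)) ∧
  (∀ s : Finset V, IsFacet G s → ∃ i, i < r ∧ F i = s) ∧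
  (∀ i j, i < r → j < r → F i = F j → i = j)


/-! ### Auxiliary: sorting -/

lemma exists_perm_of_key {n : ℕ} (f : Fin n → ℕ) :
    ∃ σ : Equiv.Perm (Fin n), ∀ a b, σ a < σ b → f a ≤ f b := by
  refine ⟨(Tuple.sort f).symm, fun a b h => ?_⟩
  have := Tuple.monotone_sort f h.le
  simpa using this

lemma exists_facet {n : ℕ} (G : SimpleGraph (Fin n)) (s : Finset (Fin n))
    (hs : G.IsClique (s : Set (Fin n))) : ∃ t, IsFacet G t ∧ s ⊆ t := by
  classical
  obtain ⟨t, hst, ht⟩ := (Set.toFinite {t : Finset (Fin n) | G.IsClique (t : Set (Fin n))}).exists_le_maximal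
    (a := s) hs
  exact ⟨t, ⟨ht.1, fun u hu htu => Finset.Subset.antisymm htu (ht.2 hu htu)⟩, hst⟩

/-! ### (2) ⇒ (1) -/

lemma two_one {n : ℕ} (G : SimpleGraph (Fin n)) (F : ℕ → Finset (Fin n)) (r : ℕ)
    (hF : FacetEnum G F r) (hC : ClosedLQT F r) :
    ∃ σ : Equiv.Perm (Fin n), ClosedWrt G (fun a b => σ a < σ b) := by
  classical
  obtain ⟨h1, h2, -⟩ := hF
  obtain ⟨hQ, -, hC⟩ := hC
  have step : ∀ i j v, i < j → j < r → v ∈ F i → v ∈ F j → v ∈ F (i+1) := by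
    intro i j v hij hj hi hvj
    by_cases e : j = i + 1
    · exact e ▸ hvj
    · have := (hQ i (by omega)).1.2.2.2 j hij.le hj (by omega) e
      have := this (Finset.mem_inter.2 ⟨hvj, hi⟩)
      exact (Finset.mem_inter.1 this).1
  have conv : ∀ d i j v, i + d ≤ j → j < r → v ∈ F i → v ∈ F j → v ∈ F (i+d) := by
    intro d
    induction d with
    | zero => intro i j v _ _ h _; exact h
    | succ d ih =>
      intro i j v hij hj hi hvj
      exact step (i+d) j v (by omega) hj (ih i j v (by omega) hj hi hvj) hvj
  have ex : ∀ v, ∃ p q, p ≤ q ∧ q < r ∧ ∀ i, i < r → (v ∈ F i ↔ p ≤ i ∧ i ≤ q) := by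
    intro v
    let S := (Finset.range r).filter (fun i => v ∈ F i)
    have hS : S.Nonempty := by
      obtain ⟨t, ht, hvt⟩ := exists_facet G {v} (by simp)
      obtain ⟨i, hi, rfl⟩ := h2 t ht
      exact ⟨i, by simp [S, hi]; simpa using hvt⟩
    have hp := S.min'_mem hS
    have hq := S.max'_mem hS
    have hp' := hp
    have hq' := hq
    simp only [S, Finset.mem_filter, Finset.mem_range] at hp' hq'
    refine ⟨S.min' hS, S.max' hS, S.min'_le _ hq, hq'.1, fun i hi => ⟨fun h => ?_, fun h => ?_⟩⟩
    · have : i ∈ S := by simp [S, hi, h]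
      exact ⟨S.min'_le _ this, S.le_max' _ this⟩
    · have := conv (i - S.min' hS) (S.min' hS) (S.max' hS) v (by omega) hq'.1 hp'.2 hq'.2
      rwa [Nat.add_sub_cancel' h.1] at this
  choose p q hpq hq hm using ex
  have nest : ∀ u v, p u < p v → q v < q u → False := by
    intro u v h h'
    have := hpq v
    have := hq u
    have hc := hC (p v - 1) (q v - p v + 1) (by omega) (by omega)
    have e1 : p v - 1 + 1 = p v := by omega
    have e2 : p v - 1 + (q v - p v + 1) = q v := by omega
    rw [e1, e2] at hc
    have hc := hc ⟨u, by
      rw [Finset.mem_inter, hm u _ (by omega), hm u _ (by omega)]; omega⟩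
    have hv : v ∈ F (p v) ∩ F (q v) := by
      rw [Finset.mem_inter, hm v _ (by omega), hm v _ (by omega)]; omega
    rw [hc, Finset.mem_union, Finset.mem_inter, Finset.mem_inter, hm v _ (by omega),
      hm v _ (by omega), hm v _ (by omega), hm v _ (by omega)] at hv
    omega
  have adj : ∀ u v, G.Adj u v → p u ≤ q v := by
    intro u v h
    obtain ⟨t, ht, hvt⟩ := exists_facet G {u, v} (by
      simp [SimpleGraph.isClique_iff, Set.pairwise_insert, h, h.symm])
    obtain ⟨i, hi, rfl⟩ := h2 t ht
    have a1 := (hm u i hi).1 (hvt (by simp))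
    have a2 := (hm v i hi).1 (hvt (by simp))
    omega
  obtain ⟨σ, hσ⟩ := exists_perm_of_key (fun v => p v + q v)
  have key : ∀ u v, σ u < σ v → p u ≤ p v ∧ q u ≤ q v := by
    intro u v h
    have := hσ u v h
    have n1 := nest u v
    have n2 := nest v u
    by_contra hcon
    have : p u < p v ∧ q v < q u ∨ p v < p u ∧ q u < q v := by omega
    rcases this with ⟨a, b⟩ | ⟨a, b⟩
    · exact n1 a b
    · exact n2 a b
  refine ⟨σ, fun i j k hij hik hjk => ⟨fun a b => ?_, fun a b => ?_⟩⟩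
  · have := key _ _ a
    have := key _ _ b
    have := adj _ _ hij.symm
    have := adj _ _ hik.symm
    have := hq i
    exact (h1 (q i) (hq i)).1 ((hm j _ this).2 (by omega)) ((hm k _ this).2 (by omega)) hjk
  · have := key _ _ a
    have := key _ _ b
    have := adj _ _ hij
    have := adj _ _ hik
    have := hq i
    have := hpq i
    have hh : p i < r := by omega
    exact (h1 (p i) hh).1 ((hm j _ hh).2 (by omega)) ((hm k _ hh).2 (by omega)) hjk

/-! ### (1) ⇒ (2) -/

section up
variable {V : Type*} {G : SimpleGraph V} {lt : V → V → Prop}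

lemma ClosedWrt.rev (h : ClosedWrt G lt) : ClosedWrt G (fun a b => lt b a) :=
  fun i j k a b c => ⟨(h i j k a b c).2, (h i j k a b c).1⟩

lemma up_aux (h : ClosedWrt G lt) (tri : ∀ a b, lt a b ∨ a = b ∨ lt b a) {u v w : V}
    (hw : Relation.TransGen (fun a b => lt a b ∧ G.Adj a b) w v) (hu : G.Adj w u) (hl : lt w u) :
    u = v ∨ Relation.TransGen (fun a b => lt a b ∧ G.Adj a b) u v ∨
      Relation.TransGen (fun a b => lt a b ∧ G.Adj a b) v u := by
  induction hw using Relation.TransGen.head_induction_on with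
  | @single w hs =>
    by_cases e : u = v
    · exact Or.inl e
    have := (h w u v hu hs.2 e).1 hl hs.1
    rcases tri u v with t | t | t
    · exact Or.inr (Or.inl (.single ⟨t, this⟩))
    · exact Or.inl t
    · exact Or.inr (Or.inr (.single ⟨t, this.symm⟩))
  | @head w w1 hs hw ih =>
    by_cases e : u = w1
    · subst e; exact Or.inr (Or.inl hw)
    have := (h w u w1 hu hs.2 e).1 hl hs.1
    rcases tri u w1 with t | t | t
    · exact Or.inr (Or.inl (.head ⟨t, this⟩ hw))
    · exact absurd t e
    · exact ih this.symm t

lemma up_flip {u v : V} (h : Relation.TransGen (fun a b => lt a b ∧ G.Adj a b) u v) :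
    Relation.TransGen (fun a b => lt b a ∧ G.Adj a b) v u := by
  induction h with
  | single h => exact .single ⟨h.1, h.2.symm⟩
  | tail _ h ih => exact .head ⟨h.1, h.2.symm⟩ ih

lemma up_walk (h : ClosedWrt G lt) (tri : ∀ a b, lt a b ∨ a = b ∨ lt b a) {u v : V}
    (p : G.Walk u v) :
    u = v ∨ Relation.TransGen (fun a b => lt a b ∧ G.Adj a b) u v ∨
      Relation.TransGen (fun a b => lt a b ∧ G.Adj a b) v u := by
  induction p with
  | nil => exact Or.inl rfl
  | @cons u w v hu _ ih =>
    rcases ih with rfl | ih | ih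
    · rcases tri u w with t | t | t
      · exact Or.inr (Or.inl (.single ⟨t, hu⟩))
      · exact Or.inl t
      · exact Or.inr (Or.inr (.single ⟨t, hu.symm⟩))
    · rcases tri u w with t | t | t
      · exact Or.inr (Or.inl (.head ⟨t, hu⟩ ih))
      · exact absurd t hu.ne
      · exact up_aux h tri ih hu.symm t
    · rcases tri u w with t | t | t
      · have := up_aux h.rev (fun a b => by rcases tri a b with t | t | t <;> simp [t])
          (up_flip ih) hu.symm t
        rcases this with t | t | t
        · exact Or.inl t
        · exact Or.inr (Or.inr (up_flip t))
        · exact Or.inr (Or.inl (up_flip t))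
      · exact absurd t hu.ne
      · exact Or.inr (Or.inr (.tail ih ⟨t, hu.symm⟩))
end up

lemma up_of_lt {n : ℕ} {G : SimpleGraph (Fin n)} (hconn : G.Connected) {σ : Equiv.Perm (Fin n)}
    (h : ClosedWrt G (fun a b => σ a < σ b)) {u v : Fin n} (huv : σ u < σ v) :
    Relation.TransGen (fun a b => σ a < σ b ∧ G.Adj a b) u v := by
  have lts : ∀ {a b}, Relation.TransGen (fun a b => σ a < σ b ∧ G.Adj a b) a b → σ a < σ b := by
    intro a b hab
    induction hab with
    | single h => exact h.1
    | tail _ h ih => exact ih.trans h.1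
  obtain ⟨p⟩ := hconn.preconnected u v
  rcases up_walk h (fun a b => by
    rcases lt_trichotomy (σ a) (σ b) with t | t | t
    · exact Or.inl t
    · exact Or.inr (Or.inl (σ.injective t))
    · exact Or.inr (Or.inr t)) p with t | t | t
  · subst t; exact absurd huv (lt_irrefl _)
  · exact t
  · exact absurd huv (lts t).not_gt

lemma lt_of_up {n : ℕ} {G : SimpleGraph (Fin n)} {σ : Equiv.Perm (Fin n)} {a b : Fin n}
    (hab : Relation.TransGen (fun a b => σ a < σ b ∧ G.Adj a b) a b) : σ a < σ b := by
  induction hab with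
  | single h => exact h.1
  | tail _ h ih => exact ih.trans h.1

lemma between {n : ℕ} {G : SimpleGraph (Fin n)} (hconn : G.Connected) {σ : Equiv.Perm (Fin n)}
    (h : ClosedWrt G (fun a b => σ a < σ b)) {i k j : Fin n} (hij : G.Adj i j)
    (hik : σ i < σ k) (hkj : σ k < σ j) : G.Adj i k := by
  have hup := up_of_lt hconn h hik
  have hne : k ≠ j := fun e => by subst e; exact lt_irrefl _ hkj
  have hkj' : G.Adj k j := by
    clear hik
    induction hup using Relation.TransGen.head_induction_on with
    | @single i hs => exact (h i k j hs.2 hij hne).1 hs.1 (hs.1.trans hkj)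
    | @head i v hs hup ih =>
      have lts : σ v < σ k := lt_of_up hup
      have hvj : v ≠ j := fun e => by subst e; exact lt_asymm lts hkj
      exact ih ((h i v j hs.2 hij hvj).1 hs.1 (hs.1.trans (lts.trans hkj)))
  exact (h j i k hij.symm hkj'.symm (fun e => by subst e; exact lt_irrefl _ hik)).2
    (hik.trans hkj) hkj

lemma one_two {n : ℕ} (G : SimpleGraph (Fin n)) (hconn : G.Connected) (σ : Equiv.Perm (Fin n))
    (h : ClosedWrt G (fun a b => σ a < σ b)) :
    ∃ (F : ℕ → Finset (Fin n)) (r : ℕ), FacetEnum G F r ∧ ClosedLQT F r := by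
  classical
  have : Nonempty (Fin n) := hconn.nonempty
  -- facets are intervals
  have hival : ∀ s : Finset (Fin n), IsFacet G s → ∃ a b : Fin n, a ≤ b ∧
      ∀ v, v ∈ s ↔ a ≤ σ v ∧ σ v ≤ b := by
    intro s hs
    have hne : s.Nonempty := by
      by_contra hcon
      rw [Finset.not_nonempty_iff_eq_empty] at hcon
      subst hcon
      obtain ⟨v⟩ := this
      have := hs.2 {v} (by simp) (by simp)
      simp at this
    obtain ⟨u, hu, hmin⟩ := s.exists_min_image σ hne
    obtain ⟨w, hw, hmax⟩ := s.exists_max_image σ hne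
    refine ⟨σ u, σ w, hmin w hw, fun v => ⟨fun hv => ⟨hmin v hv, hmax v hv⟩, fun hv => ?_⟩⟩
    have hadj : ∀ v, σ u < σ v → σ v ≤ σ w → G.Adj u v := by
      intro v h1 h2
      have huw : G.Adj u w := hs.1 hu hw (fun e => by subst e; exact absurd h1 h2.not_gt)
      rcases h2.eq_or_lt with e | h2
      · rwa [σ.injective e]
      · exact between hconn h huw h1 h2
    have hcl : G.IsClique ((Finset.univ.filter (fun v => σ u ≤ σ v ∧ σ v ≤ σ w) :
        Finset (Fin n)) : Set (Fin n)) := by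
      intro x hx y hy hxy
      simp only [Finset.coe_filter, Finset.mem_univ, true_and, Set.mem_ofPred_eq] at hx hy
      rcases hx.1.eq_or_lt with e | h1
      · have e := σ.injective e
        subst e
        exact hadj y (lt_of_le_of_ne hy.1 (fun e => hxy (σ.injective e))) hy.2
      rcases hy.1.eq_or_lt with e | h2
      · have e := σ.injective e
        subst e
        exact (hadj x h1 hx.2).symm
      exact (h u x y (hadj x h1 hx.2) (hadj y h2 hy.2) hxy).1 h1 h2
    have := hs.2 _ hcl (fun v hv => by simp [hmin v hv, hmax v hv])
    rw [this]
    simp [hv]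
  choose! A B hAB hmem using hival
  -- strict monotonicity
  have hmono : ∀ s t, IsFacet G s → IsFacet G t → A s < A t → B s < B t := by
    intro s t hs ht hst
    by_contra hcon
    push Not at hcon
    have hts : t ⊆ s := fun v hv => by
      have := (hmem t ht v).1 hv
      exact (hmem s hs v).2 ⟨hst.le.trans this.1, this.2.trans hcon⟩
    have e := ht.2 s hs.1 hts
    subst e
    exact lt_irrefl _ hst
  have hinj : ∀ s t, IsFacet G s → IsFacet G t → A s = A t → s = t := by
    intro s t hs ht hst
    rcases le_total (B s) (B t) with hB | hB
    · refine hs.2 t ht.1 fun v hv => ?_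
      have := (hmem s hs v).1 hv
      exact (hmem t ht v).2 ⟨hst ▸ this.1, this.2.trans hB⟩
    · refine (ht.2 s hs.1 fun v hv => ?_).symm
      have := (hmem t ht v).1 hv
      exact (hmem s hs v).2 ⟨hst ▸ this.1, this.2.trans hB⟩
  let T : Finset (Finset (Fin n)) := Finset.univ.filter (IsFacet G)
  have hT : ∀ s, s ∈ T ↔ IsFacet G s := fun s => by simp [T]
  let I : Finset (Fin n) := T.image A
  let e := I.orderEmbOfFin rfl
  have hF : ∀ k, ∃ s : Finset (Fin n), ∀ hk : k < I.card, IsFacet G s ∧ A s = e ⟨k, hk⟩ := by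
    intro k
    by_cases hk : k < I.card
    · have := I.orderEmbOfFin_mem rfl ⟨k, hk⟩
      obtain ⟨s, hs, hs'⟩ := Finset.mem_image.1 this
      exact ⟨s, fun _ => ⟨(hT s).1 hs, hs'⟩⟩
    · exact ⟨∅, fun h => absurd h hk⟩
  choose F hF using hF
  have hlt : ∀ i j, j < I.card → i < j → A (F i) < A (F j) := by
    intro i j hj hij
    rw [(hF i (hij.trans hj)).2, (hF j hj).2]
    exact e.strictMono (by simpa using hij)
  have henum : FacetEnum G F I.card := by
    refine ⟨fun i hi => (hF i hi).1, fun s hs => ?_, fun i j hi hj hij => ?_⟩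
    · have : A s ∈ I := Finset.mem_image_of_mem A ((hT s).2 hs)
      have : A s ∈ Set.range e := by rw [Finset.range_orderEmbOfFin]; exact this
      obtain ⟨k, hk⟩ := this
      exact ⟨k, k.2, hinj _ _ (hF k k.2).1 hs ((hF k k.2).2.trans hk)⟩
    · rcases lt_trichotomy i j with t | t | t
      · exact absurd (hij ▸ hlt i j hj t) (lt_irrefl _)
      · exact t
      · exact absurd (hij ▸ hlt j i hi t) (lt_irrefl _)
  refine ⟨F, I.card, henum, ?_⟩
  -- pass to interval data
  clear hF
  clear_value e
  generalize I.card = r at henum hlt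
  have hfac : ∀ i, i < r → IsFacet G (F i) := henum.1
  have hle : ∀ i j, j < r → i ≤ j → A (F i) ≤ A (F j) := by
    intro i j hj hij
    rcases hij.eq_or_lt with e | t
    · rw [e]
    · exact (hlt i j hj t).le
  have hltB : ∀ i j, j < r → i < j → B (F i) < B (F j) := by
    intro i j hj hij
    exact hmono _ _ (hfac i (hij.trans hj)) (hfac j hj) (hlt i j hj hij)
  have hleB : ∀ i j, j < r → i ≤ j → B (F i) ≤ B (F j) := by
    intro i j hj hij
    rcases hij.eq_or_lt with e | t
    · rw [e]
    · exact (hltB i j hj t).le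
  have hm : ∀ i, i < r → ∀ v, v ∈ F i ↔ A (F i) ≤ σ v ∧ σ v ≤ B (F i) := fun i hi =>
    hmem _ (hfac i hi)
  have hABi : ∀ i, i < r → A (F i) ≤ B (F i) := fun i hi => hAB _ (hfac i hi)
  have hm2 : ∀ i j, i ≤ j → j < r → ∀ v, v ∈ F i ∩ F j ↔ A (F j) ≤ σ v ∧ σ v ≤ B (F i) := by
    intro i j hij hj v
    rw [Finset.mem_inter, hm i (hij.trans_lt hj), hm j hj]
    exact ⟨fun h => ⟨h.2.1, h.1.2⟩, fun h => ⟨⟨(hle i j hj hij).trans h.1, h.2⟩,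
      h.1, h.2.trans (hleB i j hj hij)⟩⟩
  have hmeet : ∀ i, i + 1 < r → A (F (i+1)) ≤ B (F i) := by
    intro i hi
    by_contra hcon
    push Not at hcon
    have hup := up_of_lt hconn h (u := σ.symm (B (F i))) (v := σ.symm (A (F (i+1)))) (by simpa)
    obtain ⟨w, hw⟩ : ∃ w, B (F i) < σ w ∧ G.Adj (σ.symm (B (F i))) w := by
      obtain ⟨w, hw, -⟩ := Relation.TransGen.head'_iff.1 hup
      exact ⟨w, by simpa using hw.1, hw.2⟩
    obtain ⟨t, ht, hvt⟩ := exists_facet G {σ.symm (B (F i)), w} (by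
      simp [SimpleGraph.isClique_iff, Set.pairwise_insert, hw.2, hw.2.symm])
    obtain ⟨k, hk, rfl⟩ := henum.2.1 t ht
    have k1 := (hm k hk _).1 (hvt (Finset.mem_insert_self _ _))
    have k2 := (hm k hk w).1 (hvt (by simp))
    simp only [Equiv.apply_symm_apply] at k1
    have hki : k ≤ i := by
      by_contra hc
      exact absurd (hle (i+1) k hk (by omega)) (not_le.2 (k1.1.trans_lt hcon))
    exact absurd (hw.1.trans_le k2.2) (not_lt.2 (hleB k i (by omega) hki))
  have hw : ∀ x : Fin n, σ (σ.symm x) = x := fun x => by simp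
  refine ⟨fun i hi => ⟨⟨by omega, hi, by omega, ?_⟩, ?_⟩, ?_, ?_⟩
  · intro j hij hj hji hji' v
    rw [Finset.inter_comm, Finset.inter_comm (F (i+1)), hm2 i j hij hj, hm2 i (i+1) (by omega) hi]
    exact fun h => ⟨(hle (i+1) j hj (by omega)).trans h.1, h.2⟩
  · rintro b ⟨hib, hb, hbi, hbr⟩
    by_contra hcon
    have := hbr (i+1) (by omega) hi (by omega) (Ne.symm hcon)
    rw [Finset.inter_comm, Finset.inter_comm (F b)] at this
    have := this ((hm2 i (i+1) (by omega) hi (σ.symm (A (F (i+1))))).2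
      (by rw [hw]; exact ⟨le_rfl, hmeet i hi⟩))
    rw [hm2 i b hib hb, hw] at this
    exact absurd this.1 (not_le.2 (hlt (i+1) b hb (by omega)))
  · intro i j k l hij hkl hik hjl hj hl ⟨v, hv⟩ ⟨v', hv'⟩
    rw [hm2 i j hij hj] at hv
    rw [hm2 k l hkl hl] at hv'
    constructor
    · intro hs
      have := hs ((hm2 i j hij hj (σ.symm (A (F j)))).2 (by rw [hw]; exact ⟨le_rfl, hv.1.trans hv.2⟩))
      rw [hm2 k l hkl hl, hw] at this
      exact absurd this.1 (not_le.2 (hlt j l hl hjl))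
    · intro hs
      have := hs ((hm2 k l hkl hl (σ.symm (B (F k)))).2
        (by rw [hw]; exact ⟨hv'.1.trans hv'.2, le_rfl⟩))
      rw [hm2 i j hij hj, hw] at this
      exact absurd this.2 (not_le.2 (hltB i k (by omega) hik))
  · intro i d hd hi ⟨v, hv⟩
    rw [hm2 i (i+d+1) (by omega) hi] at hv
    ext x
    rw [Finset.mem_union, hm2 (i+1) (i+d) (by omega) (by omega), hm2 i (i+d) (by omega) (by omega),
      hm2 (i+1) (i+d+1) (by omega) hi]
    constructor
    · rintro ⟨h1, h2⟩
      rcases le_total (σ x) (B (F i)) with h3 | h3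
      · exact Or.inl ⟨h1, h3⟩
      · exact Or.inr ⟨(hv.1.trans hv.2).trans h3, h2⟩
    · rintro (⟨h1, h2⟩ | ⟨h1, h2⟩)
      · exact ⟨h1, h2.trans (hleB i (i+1) (by omega) (by omega))⟩
      · exact ⟨(hle (i+d) (i+d+1) hi (by omega)).trans h1, h2⟩

/-! ### (3) ⇒ (1) -/

lemma XX_eq {n : ℕ} (K : Type*) [Field K] (i j : Fin n) :
    (X (Sum.inl i) * X (Sum.inr j) : MvPolynomial (Fin n ⊕ Fin n) K) = monomial (xy i j) 1 := by
  simp [X, monomial_mul, xy]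

lemma degree_binom {σ K : Type*} [Field K] (m : MonomialOrder σ) (a b : σ →₀ ℕ)
    (h : m.toSyn b < m.toSyn a) :
    m.degree (monomial a (1 : K) - monomial b 1) = a := by
  classical
  rw [MonomialOrder.degree_sub_of_lt]
  · simp [MonomialOrder.degree_monomial]
  · simpa [MonomialOrder.degree_monomial] using h

lemma degree_binom' {σ K : Type*} [Field K] (m : MonomialOrder σ) (a b : σ →₀ ℕ)
    (h : m.toSyn a < m.toSyn b) :
    m.degree (monomial a (1 : K) - monomial b 1) = b := by
  rw [← neg_sub, MonomialOrder.degree_neg, degree_binom m b a h]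

lemma binom_ne {σ K : Type*} [Field K] (a b : σ →₀ ℕ) (h : a ≠ b) :
    (monomial a (1 : K) - monomial b 1) ≠ 0 := by
  classical
  intro e
  have := congrArg (coeff a) e
  simp [coeff_monomial, h.symm] at this

lemma ldMon_image {σ K : Type*} [Field K] (m : MonomialOrder σ) (S : Set (MvPolynomial σ K)) :
    ldMon m '' S = (fun s => monomial s (1 : K)) '' (m.degree '' S) := by
  rw [Set.image_image]; rfl

/-- the order of the vertices induced by a term order -/
def vlt {n : ℕ} (m : MonomialOrder (Fin n ⊕ Fin n)) (i j : Fin n) : Prop :=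
  m.toSyn (xy j i) < m.toSyn (xy i j)

lemma xy_inj {n : ℕ} {i j k l : Fin n} (h : (xy i j) = xy k l) : i = k ∧ j = l := by
  have h1 := DFunLike.congr_fun h (Sum.inl i)
  have h2 := DFunLike.congr_fun h (Sum.inr j)
  simp [xy, Finsupp.single_apply] at h1 h2
  exact ⟨h1.symm, h2.symm⟩

lemma vlt_trans {n : ℕ} {m : MonomialOrder (Fin n ⊕ Fin n)} {i j k : Fin n}
    (h1 : vlt m i j) (h2 : vlt m j k) : vlt m i k := by
  unfold vlt at *
  have := add_lt_add h1 h2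
  have e1 : m.toSyn (xy j i) + m.toSyn (xy k j) = m.toSyn (xy k i) + m.toSyn (xy j j) := by
    simp only [← map_add, xy]; congr 1; abel
  have e2 : m.toSyn (xy i j) + m.toSyn (xy j k) = m.toSyn (xy i k) + m.toSyn (xy j j) := by
    simp only [← map_add, xy]; congr 1; abel
  rw [e1, e2] at this
  exact lt_of_add_lt_add_right this

lemma vlt_tri {n : ℕ} (m : MonomialOrder (Fin n ⊕ Fin n)) {i j : Fin n} (h : i ≠ j) :
    vlt m i j ∨ vlt m j i := by
  unfold vlt
  rcases lt_trichotomy (m.toSyn (xy j i)) (m.toSyn (xy i j)) with t | t | t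
  · exact Or.inl t
  · exact absurd (xy_inj (m.toSyn.injective t)).2 h
  · exact Or.inr t

lemma vlt_asymm {n : ℕ} {m : MonomialOrder (Fin n ⊕ Fin n)} {i j : Fin n} (h : vlt m i j)
    (h' : vlt m j i) : False := lt_asymm h h'

lemma degree_gens {n : ℕ} (K : Type*) [Field K] (G : SimpleGraph (Fin n))
    (m : MonomialOrder (Fin n ⊕ Fin n)) :
    m.degree '' edgeGens n K G = {d | ∃ i j, G.Adj i j ∧ vlt m i j ∧ d = xy i j} := by
  ext d
  constructor
  · rintro ⟨f, ⟨i, j, hij, hadj, rfl⟩, rfl⟩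
    rw [XX_eq, XX_eq]
    rcases vlt_tri m hij.ne with t | t
    · exact ⟨i, j, hadj, t, degree_binom m _ _ t⟩
    · exact ⟨j, i, hadj.symm, t, degree_binom' m _ _ t⟩
  · rintro ⟨i, j, hadj, t, rfl⟩
    rcases lt_or_gt_of_ne hadj.ne with h | h
    · refine ⟨_, ⟨i, j, h, hadj, rfl⟩, ?_⟩
      rw [XX_eq, XX_eq]
      exact degree_binom m _ _ t
    · refine ⟨_, ⟨j, i, h, hadj.symm, rfl⟩, ?_⟩
      rw [XX_eq, XX_eq]
      exact degree_binom' m _ _ t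

lemma gen_mem {n : ℕ} (K : Type*) [Field K] (G : SimpleGraph (Fin n)) {i j : Fin n}
    (h : G.Adj i j) : (X (Sum.inl i) * X (Sum.inr j) - X (Sum.inl j) * X (Sum.inr i) :
      MvPolynomial (Fin n ⊕ Fin n) K) ∈ Ideal.span (edgeGens n K G) := by
  rcases lt_or_gt_of_ne h.ne with t | t
  · exact Ideal.subset_span ⟨i, j, t, h, rfl⟩
  · rw [← neg_sub]
    exact neg_mem (Ideal.subset_span ⟨j, i, t, h.symm, rfl⟩)

lemma GB_div {n : ℕ} {K : Type*} [Field K] {G : SimpleGraph (Fin n)}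
    {m : MonomialOrder (Fin n ⊕ Fin n)} (h : HasQuadGB K G m)
    {f : MvPolynomial (Fin n ⊕ Fin n) K} (hf : f ∈ Ideal.span (edgeGens n K G)) (h0 : f ≠ 0) :
    ∃ a b, G.Adj a b ∧ vlt m a b ∧ xy a b ≤ m.degree f := by
  classical
  have : ldMon m f ∈ Ideal.span (ldMon m '' edgeGens n K G) := by
    rw [h]
    exact Ideal.subset_span ⟨f, ⟨hf, h0⟩, rfl⟩
  rw [ldMon_image, mem_ideal_span_monomial_image, degree_gens] at this
  obtain ⟨d, ⟨a, b, h1, h2, rfl⟩, h3⟩ := this (m.degree f) (by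
    change m.degree f ∈ (monomial (m.degree f) (1 : K)).support
    simp [support_monomial])
  exact ⟨a, b, h1, h2, h3⟩

lemma three_one_aux {n : ℕ} {K : Type*} [Field K] {G : SimpleGraph (Fin n)}
    {m : MonomialOrder (Fin n ⊕ Fin n)} (h : HasQuadGB K G m) (i j k : Fin n)
    (hij : G.Adj i j) (hik : G.Adj i k) (hjk : vlt m j k) :
    ((vlt m i j → vlt m i k → G.Adj j k) ∧ (vlt m j i → vlt m k i → G.Adj j k)) := by
  constructor
  · intro a b
    have hmem : (monomial (xy j k + Finsupp.single (Sum.inr i) 1) (1 : K) -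
        monomial (xy k j + Finsupp.single (Sum.inr i) 1) 1) ∈ Ideal.span (edgeGens n K G) := by
      have e : (monomial (xy j k + Finsupp.single (Sum.inr i) 1) (1 : K) -
        monomial (xy k j + Finsupp.single (Sum.inr i) 1) 1) =
          X (Sum.inr j) * (X (Sum.inl i) * X (Sum.inr k) - X (Sum.inl k) * X (Sum.inr i)) -
          X (Sum.inr k) * (X (Sum.inl i) * X (Sum.inr j) - X (Sum.inl j) * X (Sum.inr i)) := by
        have hm : ∀ a b c : Fin n, monomial (xy a b + Finsupp.single (Sum.inr c) 1) (1 : K) =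
            X (Sum.inl a) * X (Sum.inr b) * X (Sum.inr c) := by
          intro a b c
          rw [XX_eq]; simp [X, monomial_mul]
        rw [hm, hm]; ring
      rw [e]
      exact sub_mem (Ideal.mul_mem_left _ _ (gen_mem K G hik)) (Ideal.mul_mem_left _ _ (gen_mem K G hij))
    have hlt : m.toSyn (xy k j + Finsupp.single (Sum.inr i) 1) <
        m.toSyn (xy j k + Finsupp.single (Sum.inr i) 1) := by
      rw [map_add, map_add]; exact add_lt_add_left hjk _
    obtain ⟨c, d, h1, h2, h3⟩ := GB_div h hmem (binom_ne _ _ (fun e => by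
      rw [e] at hlt; exact lt_irrefl _ hlt))
    rw [degree_binom m _ _ hlt] at h3
    have h4 := h3 (Sum.inl c)
    have h5 := h3 (Sum.inr d)
    simp [xy, Finsupp.single_apply] at h4 h5
    have hc : j = c := by by_contra hc; simp [hc] at h4
    subst hc
    have hd : k = d ∨ i = d := by
      by_contra hc
      push Not at hc
      simp [hc] at h5
    rcases hd with rfl | rfl
    · exact h1
    · exact (vlt_asymm a h2).elim
  · intro a b
    have hmem : (monomial (xy j k + Finsupp.single (Sum.inl i) 1) (1 : K) -
        monomial (xy k j + Finsupp.single (Sum.inl i) 1) 1) ∈ Ideal.span (edgeGens n K G) := by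
      have e : (monomial (xy j k + Finsupp.single (Sum.inl i) 1) (1 : K) -
        monomial (xy k j + Finsupp.single (Sum.inl i) 1) 1) =
          X (Sum.inl j) * (X (Sum.inl i) * X (Sum.inr k) - X (Sum.inl k) * X (Sum.inr i)) -
          X (Sum.inl k) * (X (Sum.inl i) * X (Sum.inr j) - X (Sum.inl j) * X (Sum.inr i)) := by
        have hm : ∀ a b c : Fin n, monomial (xy a b + Finsupp.single (Sum.inl c) 1) (1 : K) =
            X (Sum.inl a) * X (Sum.inr b) * X (Sum.inl c) := by
          intro a b c
          rw [XX_eq]; simp [X, monomial_mul]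
        rw [hm, hm]; ring
      rw [e]
      exact sub_mem (Ideal.mul_mem_left _ _ (gen_mem K G hik)) (Ideal.mul_mem_left _ _ (gen_mem K G hij))
    have hlt : m.toSyn (xy k j + Finsupp.single (Sum.inl i) 1) <
        m.toSyn (xy j k + Finsupp.single (Sum.inl i) 1) := by
      rw [map_add, map_add]; exact add_lt_add_left hjk _
    obtain ⟨c, d, h1, h2, h3⟩ := GB_div h hmem (binom_ne _ _ (fun e => by
      rw [e] at hlt; exact lt_irrefl _ hlt))
    rw [degree_binom m _ _ hlt] at h3
    have h4 := h3 (Sum.inl c)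
    have h5 := h3 (Sum.inr d)
    simp [xy, Finsupp.single_apply] at h4 h5
    have hd : k = d := by by_contra hc; simp [hc] at h5
    subst hd
    have hd : j = c ∨ i = c := by
      by_contra hc
      push Not at hc
      simp [hc] at h4
    rcases hd with rfl | rfl
    · exact h1
    · exact (vlt_asymm b h2).elim

lemma three_one {n : ℕ} {K : Type*} [Field K] {G : SimpleGraph (Fin n)}
    {m : MonomialOrder (Fin n ⊕ Fin n)} (h : HasQuadGB K G m) :
    ∃ σ : Equiv.Perm (Fin n), ClosedWrt G (fun a b => σ a < σ b) := by
  classical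
  obtain ⟨σ, hσ⟩ := exists_perm_of_key
    (fun v => (Finset.univ.filter (fun u => vlt m u v)).card)
  have key : ∀ a b, σ a < σ b → vlt m a b := by
    intro a b hab
    rcases vlt_tri m (i := a) (j := b) (fun e => by subst e; exact lt_irrefl _ hab) with t | t
    · exact t
    · refine absurd (hσ a b hab) (not_le.2 (Finset.card_lt_card ?_))
      rw [Finset.ssubset_iff_of_subset]
      · exact ⟨b, by simpa using t, by simpa using fun h => vlt_asymm h h⟩
      · intro x hx
        simp only [Finset.mem_filter, Finset.mem_univ, true_and] at hx ⊢
        exact vlt_trans hx t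
  refine ⟨σ, fun i j k hij hik hjk => ?_⟩
  rcases vlt_tri m hjk with t | t
  · have := three_one_aux h i j k hij hik t
    exact ⟨fun a b => this.1 (key _ _ a) (key _ _ b), fun a b => this.2 (key _ _ a) (key _ _ b)⟩
  · have := three_one_aux h i k j hik hij t
    exact ⟨fun a b => (this.1 (key _ _ b) (key _ _ a)).symm,
      fun a b => (this.2 (key _ _ b) (key _ _ a)).symm⟩

/-! ### (1) ⇒ (3) -/

universe u

/-- universe lift of a term order -/
noncomputable def liftOrder {τ : Type} (m : MonomialOrder.{0, 0} τ) : MonomialOrder.{0, u} τ where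
  syn := ULift.{u} m.syn
  isOrderedAddMonoid_syn := ⟨fun a b h c => by
    change a.down + c.down ≤ b.down + c.down
    exact add_le_add (show a.down ≤ b.down from h) le_rfl, fun a b h c => by
    change c.down + a.down ≤ c.down + b.down
    exact add_le_add le_rfl (show a.down ≤ b.down from h)⟩
  toSyn := m.toSyn.trans AddEquiv.ulift.symm
  toSyn_monotone := fun a b h => m.toSyn_monotone h

lemma liftOrder_lex_lt {τ : Type} [LinearOrder τ] [WellFoundedGT τ] (c d : τ →₀ ℕ) (a : τ)
    (h : ∀ x, x < a → c x = d x) (h' : c a < d a) :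
    (liftOrder.{u} (MonomialOrder.lex (σ := τ))).toSyn c < (liftOrder.{u} MonomialOrder.lex).toSyn d := by
  change toLex c < toLex d
  exact Finsupp.lex_def.2 ⟨a, h, h'⟩

lemma exists_order {n : ℕ} (σ : Equiv.Perm (Fin n)) :
    ∃ m : MonomialOrder.{0, u} (Fin n ⊕ Fin n), ∀ i j, σ i < σ j → vlt m i j := by
  let f : Fin n ⊕ Fin n → Fin n ⊕ₗ Fin n := fun x => toLex (Sum.map σ σ x)
  have hf : Function.Injective f :=
    toLex.injective.comp (Sum.map_injective.2 ⟨σ.injective, σ.injective⟩)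
  let lo : LinearOrder (Fin n ⊕ Fin n) := LinearOrder.lift' f hf
  have wf : @WellFoundedGT (Fin n ⊕ Fin n) lo.toLT :=
    @Finite.to_wellFoundedGT _ _ lo.toPreorder
  refine ⟨liftOrder (@MonomialOrder.lex _ lo wf), fun i j hij => ?_⟩
  have hne : j ≠ i := fun e => by subst e; exact lt_irrefl _ hij
  refine @liftOrder_lex_lt _ lo wf _ _ (Sum.inl i) (fun x hx => ?_) ?_
  · have hx : f x < f (Sum.inl i) := hx
    rcases x with x | x
    · have hx : σ x < σ i := Sum.Lex.inl_lt_inl_iff.1 hx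
      have h1 : i ≠ x := fun e => by subst e; exact lt_irrefl _ hx
      have h2 : j ≠ x := fun e => by subst e; exact lt_asymm hij hx
      simp [xy, Finsupp.single_apply, h1, h2]
    · exact absurd hx Sum.Lex.not_inr_lt_inl
  · simp [xy, Finsupp.single_apply, hne]

/-- one reduction step -/
def Red {n : ℕ} (G : SimpleGraph (Fin n)) (σ : Equiv.Perm (Fin n))
    (d d' : (Fin n ⊕ Fin n) →₀ ℕ) : Prop :=
  ∃ c i j, G.Adj i j ∧ σ i < σ j ∧ d = c + xy i j ∧ d' = c + xy j i

lemma red_join {n : ℕ} {G : SimpleGraph (Fin n)} {σ : Equiv.Perm (Fin n)}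
    (h : ClosedWrt G (fun a b => σ a < σ b)) (a b c : (Fin n ⊕ Fin n) →₀ ℕ)
    (hab : Red G σ a b) (hac : Red G σ a c) :
    ∃ d, Relation.ReflGen (Red G σ) b d ∧ Relation.ReflTransGen (Red G σ) c d := by
  classical
  obtain ⟨p, i, j, hij, lij, rfl, rfl⟩ := hab
  obtain ⟨q, k, l, hkl, lkl, e, rfl⟩ := hac
  have split : ∀ (u v : Fin n ⊕ Fin n) (p q : (Fin n ⊕ Fin n) →₀ ℕ), u ≠ v →
      p + Finsupp.single u 1 = q + Finsupp.single v 1 →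
      ∃ t, p = t + Finsupp.single v 1 ∧ q = t + Finsupp.single u 1 := by
    intro u v p q huv e
    have hle : Finsupp.single v 1 ≤ p := by
      rw [Finsupp.single_le_iff]
      have := DFunLike.congr_fun e v
      simp [huv] at this
      omega
    obtain ⟨t, rfl⟩ := exists_add_of_le hle
    refine ⟨t, add_comm _ _, ?_⟩
    have : q + Finsupp.single v 1 = (t + Finsupp.single u 1) + Finsupp.single v 1 := by
      rw [← e]; abel
    exact add_right_cancel this
  by_cases h1 : i = k
  · subst h1
    by_cases h2 : j = l
    · subst h2
      have := add_right_cancel e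
      subst this
      exact ⟨_, .refl, .refl⟩
    · have e' : p + Finsupp.single (Sum.inr j) 1 = q + Finsupp.single (Sum.inr l) 1 := by
        apply add_right_cancel (b := Finsupp.single (Sum.inl i) 1)
        simp only [xy] at e
        rw [add_assoc, add_assoc, add_comm (Finsupp.single (Sum.inr j) 1), e,
          add_comm (Finsupp.single (Sum.inr l) 1)]
      obtain ⟨t, rfl, rfl⟩ := split _ _ _ _ (by simpa using h2) e'
      have hjl := (h i j l hij hkl h2).1 lij lkl
      rcases lt_or_gt_of_ne (fun e => h2 (σ.injective e)) with g | g
      · refine ⟨_, .single ⟨t + Finsupp.single (Sum.inr i) 1, j, l, hjl, g, ?_, rfl⟩, ?_⟩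
        · simp only [xy]; abel
        · convert Relation.ReflTransGen.refl using 1
          simp only [xy]; abel
      · refine ⟨_, .refl, .single ⟨t + Finsupp.single (Sum.inr i) 1, l, j, hjl.symm, g, ?_, ?_⟩⟩ <;>
        · simp only [xy]; abel
  · by_cases h2 : j = l
    · subst h2
      have e' : p + Finsupp.single (Sum.inl i) 1 = q + Finsupp.single (Sum.inl k) 1 := by
        apply add_right_cancel (b := Finsupp.single (Sum.inr j) 1)
        simp only [xy] at e
        rw [add_assoc, add_assoc, e]
      obtain ⟨t, rfl, rfl⟩ := split _ _ _ _ (by simpa using h1) e'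
      have hik := (h j i k hij.symm hkl.symm h1).2 lij lkl
      rcases lt_or_gt_of_ne (fun e => h1 (σ.injective e)) with g | g
      · refine ⟨_, .refl, .single ⟨t + Finsupp.single (Sum.inl j) 1, i, k, hik, g, ?_, ?_⟩⟩ <;>
        · simp only [xy]; abel
      · refine ⟨_, .single ⟨t + Finsupp.single (Sum.inl j) 1, k, i, hik.symm, g, ?_, rfl⟩, ?_⟩
        · simp only [xy]; abel
        · convert Relation.ReflTransGen.refl using 1
          simp only [xy]; abel
    · simp only [xy, ← add_assoc] at e
      have e' : (p + Finsupp.single (Sum.inr j) 1) + Finsupp.single (Sum.inl i) 1 =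
          (q + Finsupp.single (Sum.inr l) 1) + Finsupp.single (Sum.inl k) 1 := by
        rw [add_right_comm, e, add_right_comm]
      obtain ⟨t, ht, ht'⟩ := split _ _ _ _ (by simpa using h1) e'
      obtain ⟨s, rfl, hs'⟩ := split _ _ _ _ (by simp) ht
      obtain ⟨s', rfl, hs''⟩ := split _ _ _ _ (by simp) ht'
      have e3 : s + Finsupp.single (Sum.inr j) 1 = s' + Finsupp.single (Sum.inr l) 1 := by
        rw [← hs', ← hs'']
      obtain ⟨w, rfl, rfl⟩ := split _ _ _ _ (by simpa using h2) e3
      refine ⟨w + xy j i + xy l k, .single ⟨w + xy j i, k, l, hkl, lkl, ?_, rfl⟩,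
        .single ⟨w + xy l k, i, j, hij, lij, ?_, ?_⟩⟩ <;>
      · simp only [xy]; abel

lemma one_three {n : ℕ} (K : Type*) [Field K] {G : SimpleGraph (Fin n)} {σ : Equiv.Perm (Fin n)}
    (h : ClosedWrt G (fun a b => σ a < σ b)) :
    ∃ m : MonomialOrder.{0, u} (Fin n ⊕ Fin n), HasQuadGB K G m := by
  classical
  obtain ⟨m, hm⟩ := exists_order.{u} σ
  have hm' : ∀ i j, vlt m i j → σ i < σ j := by
    intro i j hij
    rcases lt_trichotomy (σ i) (σ j) with t | t | t
    · exact t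
    · have := σ.injective t
      subst this
      exact (vlt_asymm hij hij).elim
    · exact (vlt_asymm hij (hm _ _ t)).elim
  refine ⟨m, le_antisymm (Ideal.span_mono (Set.image_mono ?_)) (Ideal.span_le.2 ?_)⟩
  · rintro f ⟨i, j, hij, hadj, rfl⟩
    refine ⟨gen_mem K G hadj, ?_⟩
    rw [XX_eq, XX_eq]
    exact binom_ne _ _ (fun e => hij.ne (xy_inj e).1)
  rintro _ ⟨f, ⟨hf, h0⟩, rfl⟩
  rw [SetLike.mem_coe, ldMon_image, degree_gens, mem_ideal_span_monomial_image]
  intro d hd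
  have hd : d = m.degree f := by
    have hd : d ∈ (monomial (m.degree f) (1 : K)).support := hd
    simpa [support_monomial] using hd
  subst hd
  by_contra hcon
  -- equivalence class of the leading monomial
  set d₀ := m.degree f with hd₀
  let P : ((Fin n ⊕ Fin n) →₀ ℕ) → Prop := fun d => Relation.ReflTransGen (Red G σ) d d₀
  have irr : ∀ e, Relation.ReflTransGen (Red G σ) d₀ e → d₀ = e := by
    intro e he
    rcases Relation.ReflTransGen.cases_head he with e | ⟨c, ⟨q, i, j, hij, lij, e, -⟩, -⟩
    · exact e
    · exact absurd ⟨_, ⟨i, j, hij, hm _ _ lij, rfl⟩, by rw [e]; exact le_add_self⟩ hcon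
  have hP : ∀ d d', Red G σ d d' → (P d ↔ P d') := by
    intro d d' hr
    constructor
    · intro hp
      obtain ⟨e, h1, h2⟩ := Relation.church_rosser (red_join h) hp (.single hr)
      rw [← irr e h1] at h2
      exact h2
    · intro hp
      exact .head hr hp
  have hPle : ∀ d, P d → m.toSyn d₀ ≤ m.toSyn d := by
    intro d hd
    induction hd using Relation.ReflTransGen.head_induction_on with
    | refl => exact le_rfl
    | head hr _ ih =>
      obtain ⟨q, i, j, hij, lij, rfl, rfl⟩ := hr
      refine ih.trans ?_
      rw [map_add, map_add]
      exact add_le_add_right (le_of_lt (hm i j lij)) _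
  let φ : MvPolynomial (Fin n ⊕ Fin n) K →ₗ[K] K :=
    (basisMonomials (Fin n ⊕ Fin n) K).constr K (fun d => if P d then 1 else 0)
  have hφ : ∀ d c, φ (monomial d c) = if P d then c else 0 := by
    intro d c
    have : monomial d c = c • (basisMonomials (Fin n ⊕ Fin n) K) d := by
      simp [smul_monomial]
    rw [this, map_smul, Module.Basis.constr_basis]
    simp
  have hker : ∀ f' ∈ Ideal.span (edgeGens n K G), ∀ g, φ (g * f') = 0 := by
    intro f' hf'
    induction hf' using Submodule.span_induction with
    | zero => simp
    | add x y _ _ hx hy => intro g; rw [mul_add, map_add, hx, hy, add_zero]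
    | smul a x _ hx => intro g; rw [smul_eq_mul, ← mul_assoc]; exact hx _
    | mem x hx =>
      obtain ⟨i, j, hij, hadj, rfl⟩ := hx
      rw [XX_eq, XX_eq]
      intro g
      induction g using MvPolynomial.induction_on' with
      | add p q hp hq => rw [add_mul, map_add, hp, hq, add_zero]
      | monomial u a =>
        rw [mul_sub, map_sub, monomial_mul, monomial_mul, hφ, hφ]
        have : P (u + xy i j) ↔ P (u + xy j i) := by
          rcases lt_or_gt_of_ne (fun e => hadj.ne (σ.injective e)) with g | g
          · exact hP _ _ ⟨u, i, j, hadj, g, rfl, rfl⟩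
          · exact (hP _ _ ⟨u, j, i, hadj.symm, g, rfl, rfl⟩).symm
        simp [this]
  have h1 := hker f hf 1
  rw [one_mul, f.as_sum, map_sum, Finset.sum_eq_single d₀] at h1
  · rw [hφ, if_pos Relation.ReflTransGen.refl] at h1
    exact m.coeff_degree_ne_zero_iff.2 h0 h1
  · intro d hd hne
    rw [hφ, if_neg]
    intro hp
    exact hne (m.toSyn.injective (le_antisymm (m.le_degree hd) (hPle d hp)))
  · intro hn
    exact absurd ((m.degree_mem_support_iff f).2 h0) hn

/-- For a (connected) graph `G` on `[n]` the following are equivalent: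
(1) `G` is closed with respect to some labelling of its vertices;
(2) the clique complex `Δ(G)` is a closed (linear quasi-tree) complex;
(3) the binomial edge ideal `J_G` has a quadratic Gröbner basis w.r.t. some term order. -/
theorem stmt13 {n : ℕ} (K : Type*) [Field K] (G : SimpleGraph (Fin n))
    (hconn : G.Connected) :
    ((∃ σ : Equiv.Perm (Fin n), ClosedWrt G (fun a b => σ a < σ b)) ↔
      (∃ (F : ℕ → Finset (Fin n)) (r : ℕ), FacetEnum G F r ∧ ClosedLQT F r)) ∧
    ((∃ σ : Equiv.Perm (Fin n), ClosedWrt G (fun a b => σ a < σ b)) ↔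
      (∃ m : MonomialOrder (Fin n ⊕ Fin n), HasQuadGB K G m)) := by
  exact ⟨⟨fun ⟨σ, h⟩ => one_two G hconn σ h, fun ⟨F, r, h1, h2⟩ => two_one G F r h1 h2⟩,
    ⟨fun ⟨_, h⟩ => one_three K h, fun ⟨_, h⟩ => three_one h⟩⟩
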